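/- Let 0 < α < 1 and ξ ∈ ℝ. Define e_ξ(t) := ω(t)^{-1} e^{iξψ(t)}. Then for every t ∈ ℝ the weighted Marchaud integral applied to e_ξ converges absolutely and (c_α/ω(t)) ∫_{-∞}^t (ω(t)e_ξ(t) − ω(τ)e_ξ(τ)) (ψ(t) − ψ(τ))^{−1−α} ψ'(τ) dτ = (iξ)^α e_ξ(t), where c_α = α/Γ(1−α); that is, the functions e_ξ are eigenfunctions of the weighted Weyl derivative 𝔇^α_{ψ,ω} with eigenvalue (iξ)^α (principal branch). -/

import Mathlib

open MeasureTheory Set Filter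

noncomputable section

open scoped Topology

lemma norm_one_sub_cexp_neg_le {w : ℂ} (hw : 0 ≤ w.re) : ‖1 - Complex.exp (-w)‖ ≤ ‖w‖ := by
  have h := Convex.norm_image_sub_le_of_norm_hasDerivWithin_le (𝕜 := ℂ)
    (f := Complex.exp) (f' := Complex.exp) (s := {z : ℂ | z.re ≤ 0}) (C := 1) (x := -w) (y := 0)
    (fun x _ => (Complex.hasDerivAt_exp x).hasDerivWithinAt)
    (fun x hx => by rw [Complex.norm_exp]; exact Real.exp_le_one_iff.mpr hx)
    (convex_halfSpace_re_le 0) (by simpa using hw) (by simp)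
  simpa using h

lemma norm_one_sub_cexp_neg_le_two {w : ℂ} (hw : 0 ≤ w.re) : ‖1 - Complex.exp (-w)‖ ≤ 2 := by
  have h1 : ‖Complex.exp (-w)‖ ≤ 1 := by
    rw [Complex.norm_exp]; exact Real.exp_le_one_iff.mpr (by simpa using hw)
  calc ‖1 - Complex.exp (-w)‖ ≤ ‖(1 : ℂ)‖ + ‖Complex.exp (-w)‖ := norm_sub_le _ _
    _ ≤ 2 := by rw [norm_one]; linarith

/-- The integrand of the Marchaud derivative of `s ↦ exp (z s)` at the origin. -/
def marchaudKernel (α : ℝ) (z : ℂ) (s : ℝ) : ℂ :=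
  (1 - Complex.exp (-(z * s))) * ((s ^ (-(1 + α)) : ℝ) : ℂ)

lemma integrableOn_min_one_mul_rpow {α : ℝ} (hα : 0 < α) (hα1 : α < 1) :
    IntegrableOn (fun s : ℝ => min 1 s * s ^ (-(1 + α))) (Ioi 0) := by
  rw [← Ioc_union_Ioi_eq_Ioi (zero_le_one (α := ℝ)), integrableOn_union]
  constructor
  · have h : IntegrableOn (fun s : ℝ => s ^ (-α)) (Ioc 0 1) := by
      rw [← intervalIntegrable_iff_integrableOn_Ioc_of_le zero_le_one]
      exact intervalIntegral.intervalIntegrable_rpow' (by linarith)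
    refine h.congr_fun (fun s hs => ?_) measurableSet_Ioc
    simp only
    rw [min_eq_right hs.2, ← Real.rpow_one_add' hs.1.le (by linarith)]
    congr 1; ring
  · refine (integrableOn_Ioi_rpow_of_lt (a := -(1 + α)) (by linarith) one_pos).congr_fun
      (fun s hs => ?_) measurableSet_Ioi
    simp only
    rw [min_eq_left (le_of_lt hs), one_mul]

lemma norm_marchaudKernel_le (α : ℝ) {z : ℂ} (hz : 0 ≤ z.re) {s : ℝ} (hs : 0 < s) :
    ‖marchaudKernel α z s‖ ≤ (2 + ‖z‖) * (min 1 s * s ^ (-(1 + α))) := by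
  have hre : 0 ≤ (z * s).re := by simpa using mul_nonneg hz hs.le
  have h1 := norm_one_sub_cexp_neg_le hre
  have h2 := norm_one_sub_cexp_neg_le_two hre
  have hp := Real.rpow_nonneg hs.le (-(1 + α))
  rw [marchaudKernel, norm_mul, Complex.norm_real, Real.norm_of_nonneg hp, ← mul_assoc]
  refine mul_le_mul_of_nonneg_right ?_ hp
  rw [norm_mul, Complex.norm_real, Real.norm_of_nonneg hs.le] at h1
  have hn := norm_nonneg z
  rcases le_total 1 s with h | h
  · rw [min_eq_left h]; linarith
  · rw [min_eq_right h]; nlinarith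

lemma continuousOn_marchaudKernel (α : ℝ) (z : ℂ) : ContinuousOn (marchaudKernel α z) (Ioi 0) := by
  unfold marchaudKernel
  refine ContinuousOn.mul (by fun_prop) ?_
  refine Complex.continuous_ofReal.comp_continuousOn ?_
  exact fun s hs => (Real.continuousAt_rpow_const s _ (Or.inl (ne_of_gt hs))).continuousWithinAt

lemma integrableOn_marchaudKernel {α : ℝ} (hα : 0 < α) (hα1 : α < 1) {z : ℂ} (hz : 0 ≤ z.re) :
    IntegrableOn (marchaudKernel α z) (Ioi 0) := by
  refine ((integrableOn_min_one_mul_rpow hα hα1).const_mul (2 + ‖z‖)).mono'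
    ((continuousOn_marchaudKernel α z).aestronglyMeasurable measurableSet_Ioi) ?_
  filter_upwards [ae_restrict_mem measurableSet_Ioi] with s hs
  exact norm_marchaudKernel_le α hz hs

lemma integrableOn_rpow_mul_exp_neg {α : ℝ} (hα1 : α < 1) {r : ℝ} (hr : 0 < r) :
    IntegrableOn (fun s : ℝ => s ^ (-α) * Real.exp (-(r * s))) (Ioi 0) := by
  have := integrableOn_rpow_mul_exp_neg_mul_rpow (p := 1) (s := -α) (by linarith) one_pos hr
  simpa using this

lemma hasDerivAt_integral_marchaudKernel {α : ℝ} (hα : 0 < α) (hα1 : α < 1) {z : ℂ}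
    (hz : 0 < z.re) :
    HasDerivAt (fun w : ℂ => ∫ s in Ioi (0 : ℝ), marchaudKernel α w s)
      (∫ s in Ioi (0 : ℝ), ((s ^ (-α) : ℝ) : ℂ) * Complex.exp (-(z * s))) z := by
  have hball : ∀ w ∈ Metric.ball z (z.re / 2), z.re / 2 < w.re := by
    intro w hw
    have h := (Complex.abs_re_le_norm (w - z)).trans_lt (by simpa [dist_eq_norm] using hw)
    rw [Complex.sub_re, abs_lt] at h
    linarith [h.1]
  refine (hasDerivAt_integral_of_dominated_loc_of_deriv_le
    (F' := fun (w : ℂ) (s : ℝ) => ((s ^ (-α) : ℝ) : ℂ) * Complex.exp (-(w * s)))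
    (bound := fun s => s ^ (-α) * Real.exp (-(z.re / 2 * s)))
    (Metric.ball_mem_nhds z (half_pos hz)) ?_ ?_ ?_ ?_ ?_ ?_).2
  · exact Eventually.of_forall fun w =>
      (continuousOn_marchaudKernel α w).aestronglyMeasurable measurableSet_Ioi
  · exact integrableOn_marchaudKernel hα hα1 hz.le
  · refine ContinuousOn.aestronglyMeasurable ?_ measurableSet_Ioi
    refine ContinuousOn.mul ?_ (by fun_prop)
    refine Complex.continuous_ofReal.comp_continuousOn ?_
    exact fun s hs => (Real.continuousAt_rpow_const s _ (Or.inl (ne_of_gt hs))).continuousWithinAt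
  · filter_upwards [ae_restrict_mem measurableSet_Ioi] with s hs w hw
    have hs : 0 < s := hs
    rw [norm_mul, Complex.norm_real, Real.norm_of_nonneg (Real.rpow_nonneg hs.le _),
      Complex.norm_exp]
    refine mul_le_mul_of_nonneg_left (Real.exp_le_exp.mpr ?_) (Real.rpow_nonneg hs.le _)
    have := hball w hw
    simp only [Complex.neg_re, Complex.re_mul_ofReal]
    nlinarith
  · exact integrableOn_rpow_mul_exp_neg hα1 (half_pos hz)
  · filter_upwards [ae_restrict_mem measurableSet_Ioi] with s hs w hw
    have hs : 0 < s := hs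
    have h : HasDerivAt (fun w : ℂ => Complex.exp (-(w * s)))
        (Complex.exp (-(w * s)) * (-(1 * s))) w :=
      (((hasDerivAt_id w).mul_const (s : ℂ)).neg).cexp
    have h2 := (h.const_sub 1).mul_const ((s ^ (-(1 + α)) : ℝ) : ℂ)
    unfold marchaudKernel
    refine h2.congr_deriv ?_
    have : s ^ (-α) = s * s ^ (-(1 + α)) := by
      rw [← Real.rpow_one_add' hs.le (by linarith)]; congr 1; ring
    rw [this]; push_cast; ring

lemma integral_marchaudKernel_ofReal {α : ℝ} (hα : 0 < α) (hα1 : α < 1) {r : ℝ} (hr : 0 < r) :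
    ∫ s in Ioi (0 : ℝ), marchaudKernel α r s = ((Real.Gamma (1 - α) / α * r ^ α : ℝ) : ℂ) := by
  have hreal : ∀ s : ℝ, marchaudKernel α r s
      = (((1 - Real.exp (-(r * s))) * s ^ (-(1 + α)) : ℝ) : ℂ) := by
    intro s; unfold marchaudKernel; push_cast; rfl
  have hint := integrableOn_marchaudKernel hα hα1 (z := r) (by simpa using hr.le)
  have hint' : IntegrableOn (fun s : ℝ => (1 - Real.exp (-(r * s))) * s ^ (-(1 + α))) (Ioi 0) := by
    have := hint.re
    simp only [hreal, RCLike.re_to_complex, Complex.ofReal_re] at this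
    exact this
  simp_rw [hreal]
  rw [integral_complex_ofReal]
  congr 1
  have hG : ∫ s in Ioi (0 : ℝ), s ^ (-α) * Real.exp (-(r * s))
      = (1 / r) ^ (1 - α) * Real.Gamma (1 - α) := by
    have := Real.integral_rpow_mul_exp_neg_mul_Ioi (a := 1 - α) (by linarith) hr
    rw [← this]
    congr 1; ext s; congr 2; ring
  have hexp := integrableOn_rpow_mul_exp_neg hα1 hr
  have hzero : Tendsto ((fun s : ℝ => 1 - Real.exp (-(r * s))) * fun s : ℝ => -α⁻¹ * s ^ (-α))
      (𝓝[>] 0) (𝓝 0) := by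
    have hlim : Tendsto (fun s : ℝ => α⁻¹ * r * s ^ (1 - α)) (𝓝[>] 0) (𝓝 0) := by
      have : ContinuousAt (fun s : ℝ => α⁻¹ * r * s ^ (1 - α)) 0 :=
        continuousAt_const.mul (Real.continuousAt_rpow_const 0 _ (Or.inr (by linarith)))
      have h := this.tendsto.mono_left (nhdsWithin_le_nhds (s := Ioi 0))
      simpa [Real.zero_rpow (by linarith : (1 - α) ≠ 0)] using h
    refine squeeze_zero_norm' ?_ hlim
    filter_upwards [self_mem_nhdsWithin] with s hs
    have hs : 0 < s := hs
    have h1 : 1 - Real.exp (-(r * s)) ≤ r * s := by linarith [Real.add_one_le_exp (-(r * s))]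
    have h0 : 0 ≤ 1 - Real.exp (-(r * s)) := by
      have : Real.exp (-(r * s)) ≤ 1 := Real.exp_le_one_iff.mpr (by nlinarith)
      linarith
    have hp := Real.rpow_nonneg hs.le (-α)
    have hsp : s ^ (1 - α) = s * s ^ (-α) := by
      rw [← Real.rpow_one_add' hs.le (by linarith)]; congr 1
    rw [Pi.mul_apply, norm_mul, norm_mul, Real.norm_of_nonneg h0, Real.norm_of_nonneg hp, norm_neg,
      Real.norm_of_nonneg (inv_pos.mpr hα).le, hsp]
    calc _ ≤ r * s * (α⁻¹ * s ^ (-α)) := by gcongr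
      _ = _ := by ring
  have hinf : Tendsto ((fun s : ℝ => 1 - Real.exp (-(r * s))) * fun s : ℝ => -α⁻¹ * s ^ (-α))
      atTop (𝓝 0) := by
    have h1 : Tendsto (fun s : ℝ => -α⁻¹ * s ^ (-α)) atTop (𝓝 0) := by
      simpa using (tendsto_rpow_neg_atTop hα).const_mul (-α⁻¹)
    have h2 : Tendsto (fun s : ℝ => 1 - Real.exp (-(r * s))) atTop (𝓝 (1 - 0)) :=
      (Real.tendsto_exp_neg_atTop_nhds_zero.comp (tendsto_id.const_mul_atTop hr)).const_sub 1
    have h3 := h2.mul h1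
    rwa [mul_zero] at h3
  have hparts := integral_Ioi_mul_deriv_eq_deriv_mul (a := 0)
    (u := fun s : ℝ => 1 - Real.exp (-(r * s))) (u' := fun s : ℝ => r * Real.exp (-(r * s)))
    (v := fun s : ℝ => -α⁻¹ * s ^ (-α)) (v' := fun s : ℝ => s ^ (-(1 + α)))
    (fun s _ => by
      have h := ((((hasDerivAt_id s).const_mul r).neg).exp).const_sub 1
      exact h.congr_deriv (by simp [mul_comm]))
    (fun s hs => by
      have h := (Real.hasDerivAt_rpow_const (p := -α) (Or.inl (ne_of_gt hs))).const_mul (-α⁻¹)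
      refine h.congr_deriv ?_
      rw [show -(1 + α) = -α - 1 by ring]
      field_simp)
    hint'
    (by
      refine IntegrableOn.congr_fun (hexp.const_mul (-α⁻¹ * r)) (fun s _ => ?_) measurableSet_Ioi
      simp only [Pi.mul_apply]; ring)
    hzero hinf
  rw [hparts]
  have : ∀ s : ℝ, r * Real.exp (-(r * s)) * (-α⁻¹ * s ^ (-α))
      = (-α⁻¹ * r) * (s ^ (-α) * Real.exp (-(r * s))) := fun s => by ring
  simp_rw [this]
  rw [integral_const_mul, hG, one_div, Real.inv_rpow hr.le, ← Real.rpow_neg hr.le]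
  have hra : r ^ α = r * r ^ (-(1 - α)) := by
    rw [← Real.rpow_one_add' hr.le (by linarith)]; congr 1; ring
  rw [hra]; ring

lemma integral_marchaudKernel_of_re_pos {α : ℝ} (hα : 0 < α) (hα1 : α < 1) {z : ℂ}
    (hz : 0 < z.re) :
    ∫ s in Ioi (0 : ℝ), marchaudKernel α z s
      = ((Real.Gamma (1 - α) / α : ℝ) : ℂ) * z ^ (α : ℂ) := by
  have hopen : IsOpen {z : ℂ | 0 < z.re} := isOpen_lt continuous_const Complex.continuous_re
  have hf : AnalyticOnNhd ℂ (fun w : ℂ => ∫ s in Ioi (0 : ℝ), marchaudKernel α w s)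
      {z : ℂ | 0 < z.re} :=
    DifferentiableOn.analyticOnNhd (fun w hw =>
      (hasDerivAt_integral_marchaudKernel hα hα1 hw).differentiableAt.differentiableWithinAt) hopen
  have hg : AnalyticOnNhd ℂ (fun w : ℂ => ((Real.Gamma (1 - α) / α : ℝ) : ℂ) * w ^ (α : ℂ))
      {z : ℂ | 0 < z.re} :=
    DifferentiableOn.analyticOnNhd (fun w hw =>
      ((differentiableAt_id.cpow_const (Or.inl hw)).const_mul _).differentiableWithinAt) hopen
  refine hf.eqOn_of_preconnected_of_frequently_eq hg (convex_halfSpace_re_gt 0).isPreconnected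
    (z₀ := 1) (by simp) ?_ hz
  have htend : Tendsto (fun r : ℝ => (r : ℂ)) (𝓝[≠] 1) (𝓝[≠] 1) := by
    refine tendsto_nhdsWithin_iff.mpr ⟨?_, ?_⟩
    · have := Complex.continuous_ofReal.tendsto 1
      rw [Complex.ofReal_one] at this
      exact this.mono_left nhdsWithin_le_nhds
    · filter_upwards [self_mem_nhdsWithin] with r hr
      simpa using hr
  refine htend.frequently (Eventually.frequently ?_)
  filter_upwards [nhdsWithin_le_nhds (Ioi_mem_nhds (zero_lt_one (α := ℝ)))] with r hr
  have hr : 0 < r := hr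
  rw [integral_marchaudKernel_ofReal hα hα1 hr, Complex.ofReal_mul, Complex.ofReal_cpow hr.le]

lemma integral_marchaudKernel_I_mul {α : ℝ} (hα : 0 < α) (hα1 : α < 1) (ξ : ℝ) :
    ∫ s in Ioi (0 : ℝ), marchaudKernel α (Complex.I * ξ) s
      = ((Real.Gamma (1 - α) / α : ℝ) : ℂ) * (Complex.I * ξ) ^ (α : ℂ) := by
  rcases eq_or_ne ξ 0 with rfl | hξ
  · simp [marchaudKernel, Complex.zero_cpow (Complex.ofReal_ne_zero.mpr hα.ne')]
  have hcont : Tendsto (fun ε : ℝ => (ε : ℂ) + Complex.I * ξ) (𝓝[>] 0) (𝓝 (Complex.I * ξ)) := by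
    have : Continuous (fun ε : ℝ => (ε : ℂ) + Complex.I * ξ) := by fun_prop
    have h := (this.tendsto 0).mono_left (nhdsWithin_le_nhds (s := Ioi 0))
    simpa using h
  have hleft : Tendsto (fun ε : ℝ => ∫ s in Ioi (0 : ℝ), marchaudKernel α (ε + Complex.I * ξ) s)
      (𝓝[>] 0) (𝓝 (∫ s in Ioi (0 : ℝ), marchaudKernel α (Complex.I * ξ) s)) := by
    refine tendsto_integral_filter_of_dominated_convergence
      (fun s => (2 + (1 + |ξ|)) * (min 1 s * s ^ (-(1 + α)))) ?_ ?_
      ((integrableOn_min_one_mul_rpow hα hα1).const_mul _) ?_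
    · exact Eventually.of_forall fun ε =>
        (continuousOn_marchaudKernel α _).aestronglyMeasurable measurableSet_Ioi
    · filter_upwards [Ioo_mem_nhdsGT (zero_lt_one (α := ℝ))] with ε hε
      filter_upwards [ae_restrict_mem measurableSet_Ioi] with s hs
      have hs : 0 < s := hs
      refine (norm_marchaudKernel_le α (by simpa using hε.1.le) hs).trans ?_
      have hn : ‖(ε : ℂ) + Complex.I * ξ‖ ≤ 1 + |ξ| := by
        refine (norm_add_le _ _).trans ?_
        simp only [norm_mul, Complex.norm_I, one_mul, Complex.norm_real, Real.norm_eq_abs,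
          abs_of_pos hε.1]
        linarith [hε.2]
      have hp := Real.rpow_nonneg hs.le (-(1 + α))
      gcongr
    · refine Eventually.of_forall fun s => ?_
      unfold marchaudKernel
      exact ((((hcont.mul_const _).neg).cexp).const_sub 1).mul_const _
  have hright : Tendsto (fun ε : ℝ => ((Real.Gamma (1 - α) / α : ℝ) : ℂ)
      * ((ε : ℂ) + Complex.I * ξ) ^ (α : ℂ)) (𝓝[>] 0)
      (𝓝 (((Real.Gamma (1 - α) / α : ℝ) : ℂ) * (Complex.I * ξ) ^ (α : ℂ))) :=
    ((continuousAt_cpow_const (Or.inr (by simpa using hξ))).tendsto.comp hcont).const_mul _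
  refine tendsto_nhds_unique hleft (hright.congr' ?_)
  filter_upwards [self_mem_nhdsWithin] with ε hε
  exact (integral_marchaudKernel_of_re_pos hα hα1 (by simpa using hε)).symm

lemma image_const_sub_Iio {ψ : ℝ → ℝ} (hmono : StrictMono ψ) (hcont : Continuous ψ)
    (hbot : Tendsto ψ atBot atBot) (t : ℝ) : (fun τ => ψ t - ψ τ) '' Iio t = Ioi 0 := by
  ext s
  simp only [mem_image, mem_Iio, mem_Ioi]
  constructor
  · rintro ⟨τ, hτ, rfl⟩
    exact sub_pos.mpr (hmono hτ)
  · intro hs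
    obtain ⟨a, ha, ha'⟩ := ((hbot.eventually_le_atBot (ψ t - s)).and (eventually_le_atBot t)).exists
    obtain ⟨τ, -, hτ⟩ := intermediate_value_Icc ha' hcont.continuousOn
      (show ψ t - s ∈ Icc (ψ a) (ψ t) from ⟨ha, by linarith⟩)
    exact ⟨τ, hmono.lt_iff_lt.mp (by linarith), by linarith⟩

theorem stmt_12
    (ψ ψ' ω : ℝ → ℝ)
    (hψmono : StrictMono ψ)
    (hψderiv : ∀ t, HasDerivAt ψ (ψ' t) t)
    (hψ'cont : Continuous ψ')
    (hψ'pos : ∀ t, 0 < ψ' t)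
    (hψtop : Tendsto ψ atTop atTop)
    (hψbot : Tendsto ψ atBot atBot)
    (hωmeas : Measurable ω)
    (hωpos : ∀ t, 0 < ω t)
    (hωloc : ∀ K : Set ℝ, IsCompact K → ∃ C > 0, ∀ t ∈ K, ω t ≤ C ∧ C⁻¹ ≤ ω t)
    (α : ℝ) (hα : 0 < α) (hα1 : α < 1) (ξ : ℝ)
    (e : ℝ → ℂ)
    (he : ∀ t : ℝ, e t = ((ω t : ℝ) : ℂ)⁻¹ * Complex.exp (Complex.I * (ξ : ℂ) * (ψ t : ℂ))) :
    ∀ t : ℝ,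
      IntegrableOn
        (fun τ : ℝ => (((ω t : ℝ) : ℂ) * e t - ((ω τ : ℝ) : ℂ) * e τ) *
          (((ψ t - ψ τ) ^ (-(1 + α)) * ψ' τ : ℝ) : ℂ)) (Set.Iio t) ∧
      ((α / Real.Gamma (1 - α) / ω t : ℝ) : ℂ) *
          (∫ τ in Set.Iio t, (((ω t : ℝ) : ℂ) * e t - ((ω τ : ℝ) : ℂ) * e τ) *
            (((ψ t - ψ τ) ^ (-(1 + α)) * ψ' τ : ℝ) : ℂ)) =
        (Complex.I * (ξ : ℂ)) ^ (α : ℂ) * e t := by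
  intro t
  have hωe : ∀ τ, ((ω τ : ℝ) : ℂ) * e τ = Complex.exp (Complex.I * ξ * ψ τ) := fun τ => by
    rw [he, mul_inv_cancel_left₀ (Complex.ofReal_ne_zero.mpr (hωpos τ).ne')]
  have hψcont : Continuous ψ := continuous_iff_continuousAt.mpr fun τ => (hψderiv τ).continuousAt
  have hfun : (fun τ : ℝ => (((ω t : ℝ) : ℂ) * e t - ((ω τ : ℝ) : ℂ) * e τ) *
      (((ψ t - ψ τ) ^ (-(1 + α)) * ψ' τ : ℝ) : ℂ)) =
      fun τ => Complex.exp (Complex.I * ξ * ψ t) *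
        (|-ψ' τ| • marchaudKernel α (Complex.I * ξ) (ψ t - ψ τ)) := by
    ext τ
    have hexp : Complex.exp (Complex.I * ξ * ψ τ) = Complex.exp (Complex.I * ξ * ψ t) *
        Complex.exp (-(Complex.I * ξ * ((ψ t - ψ τ : ℝ) : ℂ))) := by
      rw [← Complex.exp_add]; congr 1; push_cast; ring
    rw [hωe, hωe, abs_neg, abs_of_pos (hψ'pos τ), marchaudKernel, Complex.real_smul, hexp,
      Complex.ofReal_mul]
    ring
  have hd : ∀ τ ∈ Iio t, HasDerivWithinAt (fun τ => ψ t - ψ τ) (-ψ' τ) (Iio t) τ :=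
    fun τ _ => ((hψderiv τ).const_sub (ψ t)).hasDerivWithinAt
  have hinj : InjOn (fun τ => ψ t - ψ τ) (Iio t) := fun a _ b _ hab =>
    hψmono.injective (sub_right_injective hab)
  have himage := image_const_sub_Iio hψmono hψcont hψbot t
  rw [hfun]
  constructor
  · refine Integrable.const_mul ?_ _
    have h := integrableOn_marchaudKernel hα hα1 (z := Complex.I * ξ) (by simp)
    rw [← himage] at h
    exact (integrableOn_image_iff_integrableOn_abs_deriv_smul measurableSet_Iio hd hinj _).mp h
  · rw [integral_const_mul, ← integral_image_eq_integral_abs_deriv_smul measurableSet_Iio hd hinj,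
      himage, integral_marchaudKernel_I_mul hα hα1, he t]
    have hΓ : (Real.Gamma (1 - α) : ℂ) ≠ 0 :=
      Complex.ofReal_ne_zero.mpr (Real.Gamma_pos_of_pos (by linarith)).ne'
    have hα' : (α : ℂ) ≠ 0 := Complex.ofReal_ne_zero.mpr hα.ne'
    push_cast
    field_simp
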